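/- Let y, d be integers and Q, P positive integers with gcd(d, P) = 1. If |y/Q − d/P| < 1/(2P²) as rational numbers, then d/P is a convergent of the (canonical) continued fraction expansion of the rational number y/Q; that is, there exists an index n such that the n-th convergent of the continued fraction of y/Q equals d/P. -/

import Mathlib

theorem convergent_ratCast_aux (q : ℚ) (n : ℕ) :
    (GenContFract.of q).convs n = (q : ℝ).convergent n := by
  induction n generalizing q with
  | zero => simp
  | succ n ih =>
    rw [GenContFract.convs_succ, ih (Int.fract q)⁻¹, Real.convergent_succ, one_div]
    push_cast
    simp

/-- If `|y/Q − d/P| < 1/(2P²)` with `gcd d P = 1`, then `d/P` is a convergent of the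
continued fraction expansion of `y/Q`. -/
theorem convergent_of_close_fraction
    (y d : ℤ) (Q P : ℕ) (hQ : 0 < Q) (hP : 0 < P) (hgcd : Int.gcd d (P : ℤ) = 1)
    (h : |(y : ℚ) / (Q : ℚ) - (d : ℚ) / (P : ℚ)| < 1 / (2 * (P : ℚ) ^ 2)) :
    ∃ n : ℕ, (GenContFract.of ((y : ℚ) / (Q : ℚ))).convs n = (d : ℚ) / (P : ℚ) := by
  have hden : ((d : ℚ) / (P : ℚ)).den = P := by
    have := Rat.den_div_eq_of_coprime (a := d) (b := (P : ℤ)) (by exact_mod_cast hP)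
      (by simpa [Int.gcd] using hgcd)
    exact_mod_cast this
  have h2 : |(((y : ℚ) / (Q : ℚ) : ℚ) : ℝ) - (((d : ℚ) / (P : ℚ) : ℚ) : ℝ)|
      < 1 / (2 * ((((d : ℚ) / (P : ℚ)).den : ℕ) : ℝ) ^ 2) := by
    rw [hden]
    have h3 := (Rat.cast_lt (K := ℝ)).mpr h
    push_cast at h3 ⊢
    exact h3
  obtain ⟨n, hn⟩ := Real.exists_rat_eq_convergent h2
  exact ⟨n, by rw [convergent_ratCast_aux, ← hn]⟩
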